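/- arXiv:0707.0221 — 2 statements merged into one kernel-verified Lean document; each statement's English description precedes it below -/
import Mathlib

section
/- Let ξ be an isotropic symmetric α-stable random vector in ℝ^d with characteristic function exp(-σ^α ‖u‖^α) (Euclidean norm), α ∈ (0,2), σ > 0. Then for λ ∈ (-d, α), E[‖ξ‖^λ] = (2σ)^λ · (Γ((d+λ)/2)/Γ(d/2)) · (Γ(1-λ/α)/Γ(1-λ/2)). -/
open MeasureTheory Real Set
open scoped RealInnerProductSpace

/-- the Gaussian measure with density `π^(-d/2) exp(-‖v‖²)` -/
noncomputable def gam (d : ℕ) : Measure (EuclideanSpace ℝ (Fin d)) :=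
  (volume : Measure (EuclideanSpace ℝ (Fin d))).withDensity
    (fun v => ENNReal.ofReal (π ^ (-((d : ℝ) / 2)) * Real.exp (-‖v‖ ^ 2)))

lemma gam_integral (d : ℕ) {E : Type*} [NormedAddCommGroup E] [NormedSpace ℝ E]
    (g : EuclideanSpace ℝ (Fin d) → E) :
    ∫ v, g v ∂(gam d) = ∫ v, (π ^ (-((d : ℝ) / 2)) * Real.exp (-‖v‖ ^ 2)) • g v := by
  unfold gam
  rw [integral_withDensity_eq_integral_toReal_smul (by fun_prop) (by simp)]
  congr 1
  ext v
  rw [ENNReal.toReal_ofReal (by positivity)]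

lemma gam_char (d : ℕ) (r : ℝ) (x : EuclideanSpace ℝ (Fin d)) :
    ∫ v, Complex.exp (Complex.ofReal ⟪r • v, x⟫ * Complex.I) ∂(gam d)
      = Complex.ofReal (Real.exp (-(r ^ 2 / 4 * ‖x‖ ^ 2))) := by
  rw [gam_integral]
  have h := GaussianFourier.integral_cexp_neg_mul_sq_norm_add (b := 1) (by simp)
    (Complex.I * r) x
  have hp : (π : ℂ) ^ ((d : ℂ) / 2) = Complex.ofReal (π ^ ((d : ℝ) / 2)) := by
    rw [Complex.ofReal_cpow pi_pos.le]; push_cast; rfl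
  calc _ = ∫ v : EuclideanSpace ℝ (Fin d), Complex.ofReal (π ^ (-((d : ℝ) / 2))) *
        Complex.exp (-1 * ‖v‖ ^ 2 + Complex.I * r * ⟪x, v⟫) := by
        congr 1; ext v
        rw [Complex.exp_add, real_inner_smul_left, real_inner_comm, Complex.real_smul]
        push_cast
        rw [mul_assoc]
        congr 3 <;> ring_nf
    _ = _ := by
        rw [integral_const_mul, h]
        simp only [finrank_euclideanSpace, Fintype.card_fin, div_one, hp]
        rw [← mul_assoc, ← Complex.ofReal_mul, ← rpow_add pi_pos]
        simp only [neg_add_cancel, rpow_zero, mul_pow, Complex.I_sq]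
        push_cast
        rw [one_mul]
        congr 1; ring

lemma gam_prob (d : ℕ) : IsProbabilityMeasure (gam d) := by
  constructor
  have h := GaussianFourier.integral_rexp_neg_mul_sq_norm (V := EuclideanSpace ℝ (Fin d)) one_pos
  have hi : Integrable (fun v : EuclideanSpace ℝ (Fin d) => Real.exp (-1 * ‖v‖ ^ 2)) := by
    by_contra hc
    rw [integral_undef hc] at h
    have : 0 < (π / 1) ^ ((Module.finrank ℝ (EuclideanSpace ℝ (Fin d)) : ℝ) / 2) := by positivity
    exact this.ne h
  rw [gam, withDensity_apply _ MeasurableSet.univ, Measure.restrict_univ,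
    ← ofReal_integral_eq_lintegral_ofReal]
  · rw [integral_const_mul]
    simp only [neg_one_mul] at h
    rw [h]
    simp [← rpow_add pi_pos]
  · simp only [neg_one_mul] at hi
    exact hi.const_mul _
  · exact Filter.Eventually.of_forall fun v => by positivity

lemma radial (d : ℕ) (hd : d ≠ 0) (l : ℝ) (hl : -(d : ℝ) < l) :
    Integrable (fun v : EuclideanSpace ℝ (Fin d) => ‖v‖ ^ l * Real.exp (-‖v‖ ^ 2)) ∧
    ∫ v : EuclideanSpace ℝ (Fin d), ‖v‖ ^ l * Real.exp (-‖v‖ ^ 2) =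
      (d * (volume : Measure (EuclideanSpace ℝ (Fin d))).real (Metric.ball 0 1)) *
        (1 / 2 * Real.Gamma ((d + l) / 2)) := by
  have : Nonempty (Fin d) := ⟨⟨0, Nat.pos_of_ne_zero hd⟩⟩
  have hd1 : 1 ≤ d := Nat.one_le_iff_ne_zero.mpr hd
  have key : ∀ y ∈ Ioi (0:ℝ), y ^ ((d:ℝ) - 1 + l) * Real.exp (-1 * y ^ (2:ℝ)) =
      y ^ (d - 1) • (y ^ l * Real.exp (-y ^ 2)) := by
    intro y hy
    rw [rpow_add hy, smul_eq_mul, ← rpow_natCast y (d - 1), Nat.cast_sub hd1, rpow_two]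
    push_cast
    ring_nf
  constructor
  · rw [integrable_fun_norm_addHaar volume (f := fun y => y ^ l * Real.exp (-y ^ 2))]
    simp only [finrank_euclideanSpace, Fintype.card_fin]
    exact (integrableOn_rpow_mul_exp_neg_mul_rpow (s := (d:ℝ) - 1 + l) (by linarith) two_pos
      one_pos).congr_fun key measurableSet_Ioi
  · rw [integral_fun_norm_addHaar volume (fun y => y ^ l * Real.exp (-y ^ 2))]
    simp only [finrank_euclideanSpace, Fintype.card_fin]
    rw [← setIntegral_congr_fun measurableSet_Ioi key,
      integral_rpow_mul_exp_neg_mul_rpow two_pos (by linarith) one_pos]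
    simp only [one_rpow, nsmul_eq_mul, smul_eq_mul]
    ring_nf

lemma gam_moment (d : ℕ) (hd : d ≠ 0) (l : ℝ) (hl : -(d : ℝ) < l) :
    ∫⁻ v, ENNReal.ofReal (‖v‖ ^ l) ∂(gam d)
      = ENNReal.ofReal (Real.Gamma (((d : ℝ) + l) / 2) / Real.Gamma ((d : ℝ) / 2)) := by
  have hd0 : (0:ℝ) < d := Nat.cast_pos.mpr (Nat.pos_of_ne_zero hd)
  obtain ⟨h1, h2⟩ := radial d hd l hl
  obtain ⟨-, h3⟩ := radial d hd 0 (by linarith)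
  have h := GaussianFourier.integral_rexp_neg_mul_sq_norm (V := EuclideanSpace ℝ (Fin d)) one_pos
  simp only [neg_one_mul, div_one, finrank_euclideanSpace, Fintype.card_fin] at h
  simp only [rpow_zero, one_mul, h, add_zero] at h3
  have hG : 0 < Real.Gamma ((d:ℝ)/2) := Real.Gamma_pos_of_pos (by positivity)
  rw [gam, lintegral_withDensity_eq_lintegral_mul _ (by fun_prop) (by fun_prop)]
  have : ∀ v : EuclideanSpace ℝ (Fin d),
     ENNReal.ofReal (π ^ (-((d : ℝ) / 2)) * Real.exp (-‖v‖ ^ 2)) * ENNReal.ofReal (‖v‖ ^ l) =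
      ENNReal.ofReal (π ^ (-((d : ℝ) / 2)) * (‖v‖ ^ l * Real.exp (-‖v‖ ^ 2))) := by
    intro v
    rw [← ENNReal.ofReal_mul (by positivity)]
    ring_nf
  simp_rw [Pi.mul_apply, this]
  rw [← ofReal_integral_eq_lintegral_ofReal (h1.const_mul _)
    (Filter.Eventually.of_forall fun v => by positivity), integral_const_mul, h2, rpow_neg pi_pos.le, h3]
  congr 1
  have : (0:ℝ) < π ^ ((d:ℝ)/2) := by positivity
  rw [h3] at this
  have h5 : (volume : Measure (EuclideanSpace ℝ (Fin d))).real (Metric.ball 0 1) ≠ 0 := by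
    intro h0; simp [h0] at this
  field_simp

/-- kernel -/
noncomputable def ker (a x : ℝ) : ℝ := if a < 0 then Real.exp (-x) else 1 - Real.exp (-x)

lemma ker_nonneg (a x : ℝ) (hx : 0 ≤ x) : 0 ≤ ker a x := by
  unfold ker; split_ifs
  · positivity
  · simp [hx]

lemma ker_cont (a : ℝ) : Continuous (ker a) := by
  unfold ker; split_ifs <;> fun_prop

lemma J_neg (a p b : ℝ) (ha : a < 0) (hp : 0 < p) (hb : 0 < b) :
    ∫⁻ t in Ioi (0:ℝ), ENNReal.ofReal (t ^ (-a - 1) * ker a (b * t ^ p))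
      = ENNReal.ofReal (b ^ (a / p) * (Real.Gamma (1 - a / p) / |a|)) := by
  simp only [ker, ha, if_true, ← neg_mul]
  rw [← ofReal_integral_eq_lintegral_ofReal
    (integrableOn_rpow_mul_exp_neg_mul_rpow (by linarith) hp hb),
    integral_rpow_mul_exp_neg_mul_rpow hp (by linarith) hb]
  · congr 1
    have h : Real.Gamma (1 - a / p) = (-a / p) * Real.Gamma (-a / p) := by
      rw [← Real.Gamma_add_one (div_pos (neg_pos.mpr ha) hp).ne']
      congr 1; ring
    rw [h, abs_of_neg ha]
    have : a ≠ 0 := ha.ne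
    have e : -(-a - 1 + 1) / p = a / p := by ring
    rw [e, show -a - 1 + 1 = -a by ring]
    field_simp
  · exact (ae_restrict_mem measurableSet_Ioi).mono fun t (ht : 0 < t) => by
      simp only [Pi.zero_apply]; positivity

lemma J_pos (a p b : ℝ) (ha : 0 < a) (hp : 0 < p) (hap : a < p) (hb : 0 < b) :
    ∫⁻ t in Ioi (0:ℝ), ENNReal.ofReal (t ^ (-a - 1) * ker a (b * t ^ p))
      = ENNReal.ofReal (b ^ (a / p) * (Real.Gamma (1 - a / p) / |a|)) := by
  simp only [ker, ha.le, not_lt.mpr, if_false]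
  have h1 : ∀ t ∈ Ioi (0:ℝ), ENNReal.ofReal (t ^ (-a - 1) * (1 - Real.exp (-(b * t ^ p)))) =
      ∫⁻ x in Ioi (0:ℝ), (Iio t).indicator (fun x => ENNReal.ofReal (t ^ (-a - 1) *
        (b * p * (x ^ (p - 1) * Real.exp (-b * x ^ p))))) x := by
    intro t (ht : 0 < t)
    have hint := integrableOn_rpow_mul_exp_neg_mul_rpow (s := p - 1) (by linarith) hp hb
    have hio : IntegrableOn (fun x => b * p * (x ^ (p - 1) * Real.exp (-b * x ^ p))) (Ioo 0 t) :=
      (hint.mono_set Ioo_subset_Ioi_self).const_mul _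
    rw [lintegral_indicator measurableSet_Iio, Measure.restrict_restrict measurableSet_Iio,
      Iio_inter_Ioi, ← ofReal_integral_eq_lintegral_ofReal (hio.const_mul _)]
    · congr 1
      rw [integral_const_mul]
      congr 1
      rw [← integral_Ioc_eq_integral_Ioo, ← intervalIntegral.integral_of_le ht.le,
        intervalIntegral.integral_eq_sub_of_hasDerivAt_of_le (f := fun x => -Real.exp (-b * x ^ p))
          ht.le]
      · simp [zero_rpow hp.ne']; ring
      · have : Continuous fun x : ℝ => x ^ p := continuous_rpow_const hp.le
        exact Continuous.continuousOn (by fun_prop)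
      · intro x hx
        have := (((Real.hasDerivAt_rpow_const (p := p) (Or.inl hx.1.ne')).const_mul (-b)).exp).neg
        have e : b * p * (x ^ (p - 1) * rexp (-b * x ^ p)) =
          -(rexp (-b * x ^ p) * (-b * (p * x ^ (p - 1)))) := by ring
        rw [e]
        exact this
      · rw [intervalIntegrable_iff_integrableOn_Ioo_of_le ht.le]
        exact hio
    · exact (ae_restrict_mem measurableSet_Ioo).mono fun x hx => by
        have : 0 < x := hx.1
        simp only [Pi.zero_apply]; positivity
  rw [setLIntegral_congr_fun measurableSet_Ioi h1, lintegral_lintegral_swap]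
  · have h2 : ∀ x ∈ Ioi (0:ℝ), ∫⁻ t in Ioi (0:ℝ), (Iio t).indicator (fun x => ENNReal.ofReal
        (t ^ (-a - 1) * (b * p * (x ^ (p - 1) * Real.exp (-b * x ^ p))))) x =
        ENNReal.ofReal (b * p / a * (x ^ (p - 1 - a) * Real.exp (-b * x ^ p))) := by
      intro x (hx : 0 < x)
      have : ∀ t, (Iio t).indicator (fun x => ENNReal.ofReal
          (t ^ (-a - 1) * (b * p * (x ^ (p - 1) * Real.exp (-b * x ^ p))))) x =
          (Ioi x).indicator (fun t => ENNReal.ofReal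
          (t ^ (-a - 1) * (b * p * (x ^ (p - 1) * Real.exp (-b * x ^ p))))) t := by
        intro t; simp [indicator]
      simp_rw [this]
      rw [lintegral_indicator measurableSet_Ioi, Measure.restrict_restrict measurableSet_Ioi,
        Ioi_inter_Ioi, sup_eq_left.mpr hx.le, ← ofReal_integral_eq_lintegral_ofReal
        ((integrableOn_Ioi_rpow_of_lt (by linarith) hx).mul_const _), integral_mul_const,
        integral_Ioi_rpow_of_lt (by linarith) hx]
      · congr 1
        rw [show p - 1 - a = (p - 1) + (-a) by ring, rpow_add hx (p - 1) (-a),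
          show -a - 1 + 1 = -a by ring]
        generalize x ^ (-a) = y
        field_simp
      · exact (ae_restrict_mem measurableSet_Ioi).mono fun t (ht : x < t) => by
          have := hx.trans ht
          simp only [Pi.zero_apply]; positivity
    rw [setLIntegral_congr_fun measurableSet_Ioi h2, ← ofReal_integral_eq_lintegral_ofReal
      ((integrableOn_rpow_mul_exp_neg_mul_rpow (by linarith) hp hb).const_mul _),
      integral_const_mul, integral_rpow_mul_exp_neg_mul_rpow hp (by linarith) hb]
    · congr 1
      rw [abs_of_pos ha, show (p - 1 - a + 1) / p = 1 - a / p by field_simp; ring,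
        show -(p - 1 - a + 1) / p = a / p - 1 by field_simp; ring, rpow_sub hb, rpow_one]
      field_simp
    · exact (ae_restrict_mem measurableSet_Ioi).mono fun t (ht : 0 < t) => by
          simp only [Pi.zero_apply]; positivity
  · have : (Function.uncurry fun (t x : ℝ) => (Iio t).indicator (fun x => ENNReal.ofReal
        (t ^ (-a - 1) * (b * p * (x ^ (p - 1) * Real.exp (-b * x ^ p))))) x) =
        {q : ℝ × ℝ | q.2 < q.1}.indicator (fun q => ENNReal.ofReal
        (q.1 ^ (-a - 1) * (b * p * (q.2 ^ (p - 1) * Real.exp (-b * q.2 ^ p))))) := by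
      ext q; simp [indicator, Function.uncurry]
    rw [this]
    exact (Measurable.indicator (by fun_prop)
      (measurableSet_lt measurable_snd measurable_fst)).aemeasurable

lemma J_all (a p b : ℝ) (ha : a ≠ 0) (hp : 0 < p) (hap : a < p) (hb : 0 < b) :
    ∫⁻ t in Ioi (0:ℝ), ENNReal.ofReal (t ^ (-a - 1) * ker a (b * t ^ p))
      = ENNReal.ofReal (b ^ (a / p) * (Real.Gamma (1 - a / p) / |a|)) := by
  rcases ha.lt_or_gt with h | h
  · exact J_neg a p b h hp hb
  · exact J_pos a p b h hp hap hb

lemma J_zero_neg (a : ℝ) (ha : a < 0) :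
    ∫⁻ t in Ioi (0:ℝ), ENNReal.ofReal (t ^ (-a - 1) * ker a (0 * t)) = ⊤ := by
  simp only [ker, ha, if_true, zero_mul, neg_zero, Real.exp_zero, mul_one]
  by_contra hc
  refine not_integrableOn_Ioi_rpow (-a - 1) ⟨by fun_prop, ?_⟩
  rw [hasFiniteIntegral_iff_ofReal]
  · exact lt_top_iff_ne_top.mpr hc
  · exact (ae_restrict_mem measurableSet_Ioi).mono fun t (ht : 0 < t) => by
          simp only [Pi.zero_apply]; positivity

lemma lap {d : ℕ} {Ω : Type*} [MeasurableSpace Ω]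
    (μ : Measure Ω) [IsProbabilityMeasure μ]
    (α : ℝ) (s : ℝ) (hs : 0 < s)
    (ξ : Ω → EuclideanSpace ℝ (Fin d)) (hξ : Measurable ξ)
    (hchar : ∀ u : EuclideanSpace ℝ (Fin d),
      ∫ ω, Complex.exp (Complex.ofReal ⟪u, ξ ω⟫ * Complex.I) ∂μ
        = Complex.exp (Complex.ofReal (-(s ^ α * ‖u‖ ^ α)))) (t : ℝ) (ht : 0 < t) :
    ∫ ω, Real.exp (-(‖ξ ω‖ ^ 2 * t ^ (1:ℝ))) ∂μ =
      ∫ v, Real.exp (-((2 * s * ‖v‖) ^ α * t ^ (α / 2))) ∂(gam d) := by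
  have := gam_prob d
  have hr : (2 * √t) ^ 2 / 4 = t := by rw [mul_pow, sq_sqrt ht.le]; ring
  rw [← Complex.ofReal_inj, ← integral_complex_ofReal, ← integral_complex_ofReal]
  calc _ = ∫ ω, ∫ v, Complex.exp (Complex.ofReal ⟪(2 * √t) • v, ξ ω⟫ * Complex.I) ∂(gam d) ∂μ := by
        congr 1; ext ω
        rw [gam_char, hr, rpow_one, mul_comm]
    _ = ∫ v, ∫ ω, Complex.exp (Complex.ofReal ⟪(2 * √t) • v, ξ ω⟫ * Complex.I) ∂μ ∂(gam d) := by
        apply integral_integral_swap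
        refine Integrable.of_bound (C := 1) (Measurable.aestronglyMeasurable ?_) ?_
        · unfold Function.uncurry
          fun_prop
        · refine Filter.Eventually.of_forall fun q => ?_
          simp only [Function.uncurry]
          rw [Complex.norm_exp_ofReal_mul_I]
    _ = _ := by
        congr 1; ext v
        rw [hchar, Complex.ofReal_exp]
        congr 3
        rw [norm_smul, Real.norm_of_nonneg (by positivity), ← mul_rpow hs.le (by positivity),
          show s * (2 * √t * ‖v‖) = (2 * s * ‖v‖) * √t by ring,
          mul_rpow (by positivity) (by positivity), sqrt_eq_rpow, ← rpow_mul ht.le]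
        congr 2; ring

lemma ker_lint {X : Type*} [MeasurableSpace X] (ν : Measure X) [IsProbabilityMeasure ν] (a : ℝ)
    (f : X → ℝ) (hf : Measurable f) (h0 : ∀ x, 0 ≤ f x) :
    ∫⁻ x, ENNReal.ofReal (ker a (f x)) ∂ν = ENNReal.ofReal
      (if a < 0 then ∫ x, Real.exp (-f x) ∂ν else 1 - ∫ x, Real.exp (-f x) ∂ν) := by
  have hi : Integrable (fun x => Real.exp (-f x)) ν := by
    refine Integrable.of_bound (C := 1) (Measurable.aestronglyMeasurable (by fun_prop)) ?_
    refine Filter.Eventually.of_forall fun q => ?_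
    simp [h0 q]
  have hk : Integrable (fun x => ker a (f x)) ν := by
    unfold ker; split_ifs
    · exact hi
    · exact (integrable_const 1).sub hi
  rw [← ofReal_integral_eq_lintegral_ofReal hk
    (Filter.Eventually.of_forall fun x => ker_nonneg _ _ (h0 x))]
  congr 1
  unfold ker; split_ifs
  · rfl
  · rw [integral_sub (integrable_const 1) hi]; simp

lemma ker_tonelli {X : Type*} [MeasurableSpace X] (ν : Measure X) [IsProbabilityMeasure ν]
    (a p : ℝ) (f : X → ℝ) (hf : Measurable f) :
    ∫⁻ x, (∫⁻ t in Ioi (0:ℝ), ENNReal.ofReal (t ^ (-a - 1) * ker a (f x * t ^ p))) ∂ν =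
    ∫⁻ t in Ioi (0:ℝ), ENNReal.ofReal (t ^ (-a - 1)) *
      ∫⁻ x, ENNReal.ofReal (ker a (f x * t ^ p)) ∂ν := by
  have hm := (ker_cont a).measurable
  rw [lintegral_lintegral_swap]
  · refine setLIntegral_congr_fun measurableSet_Ioi fun t (ht : 0 < t) => ?_
    rw [← lintegral_const_mul _ (by fun_prop)]
    congr 1; ext x
    rw [ENNReal.ofReal_mul (by positivity)]
  · unfold Function.uncurry
    fun_prop

theorem isotropic_stable_norm_moments {d : ℕ} {Ω : Type*} [MeasurableSpace Ω]
    (μ : Measure Ω) [IsProbabilityMeasure μ]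
    (α : ℝ) (hα : α ∈ Set.Ioo (0 : ℝ) 2) (s : ℝ) (hs : 0 < s)
    (ξ : Ω → EuclideanSpace ℝ (Fin d)) (hξ : Measurable ξ)
    (hchar : ∀ u : EuclideanSpace ℝ (Fin d),
      ∫ ω, Complex.exp (Complex.ofReal ⟪u, ξ ω⟫ * Complex.I) ∂μ
        = Complex.exp (Complex.ofReal (-(s ^ α * ‖u‖ ^ α))))
    (l : ℝ) (hl : l ∈ Set.Ioo (-(d : ℝ)) α) :
    ∫ ω, ‖ξ ω‖ ^ l ∂μ
      = (2 * s) ^ l * (Real.Gamma (((d : ℝ) + l) / 2) / Real.Gamma ((d : ℝ) / 2))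
        * (Real.Gamma (1 - l / α) / Real.Gamma (1 - l / 2)) := by
  obtain ⟨hα0, hα2⟩ := hα
  obtain ⟨hl1, hl2⟩ := hl
  rcases eq_or_ne d 0 with rfl | hd
  · have hl0 : l ≠ 0 := by
      have : 0 < l := by simpa using hl1
      exact this.ne'
    have : ∀ ω, ‖ξ ω‖ = 0 := fun ω => by rw [Subsingleton.elim (ξ ω) 0, norm_zero]
    simp [this, zero_rpow hl0, Real.Gamma_zero]
  have hd0 : (0:ℝ) < d := Nat.cast_pos.mpr (Nat.pos_of_ne_zero hd)
  have hGd : 0 < Real.Gamma ((d:ℝ)/2) := Real.Gamma_pos_of_pos (by positivity)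
  rcases eq_or_ne l 0 with rfl | hl0
  · simp [hGd.ne']
  have hprob := gam_prob d
  have hGdl : 0 < Real.Gamma (((d:ℝ)+l)/2) := Real.Gamma_pos_of_pos (by linarith)
  have hG1 : 0 < Real.Gamma (1 - l / α) := Real.Gamma_pos_of_pos (by
    rw [sub_pos, div_lt_one hα0]; exact hl2)
  have hG2 : 0 < Real.Gamma (1 - l / 2) := Real.Gamma_pos_of_pos (by linarith)
  have ha0 : l / 2 ≠ 0 := by positivity
  have hab : 0 < |l / 2| := abs_pos.mpr ha0
  have hne : ∀ᵐ v ∂(gam d), v ≠ 0 := by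
    have : Nonempty (Fin d) := ⟨⟨0, Nat.pos_of_ne_zero hd⟩⟩
    have h0 : ∀ᵐ v : EuclideanSpace ℝ (Fin d), v ≠ 0 := by
      simp [ae_iff]
    exact (withDensity_absolutelyContinuous _ _).ae_le h0
  -- the two sides
  have main : ∫⁻ ω, (∫⁻ t in Ioi (0:ℝ), ENNReal.ofReal (t ^ (-(l/2) - 1) *
        ker (l/2) (‖ξ ω‖ ^ 2 * t ^ (1:ℝ)))) ∂μ =
      ∫⁻ v, (∫⁻ t in Ioi (0:ℝ), ENNReal.ofReal (t ^ (-(l/2) - 1) *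
        ker (l/2) ((2 * s * ‖v‖) ^ α * t ^ (α / 2)))) ∂(gam d) := by
    rw [ker_tonelli μ _ _ _ (by fun_prop), ker_tonelli (gam d) _ _ _ (by fun_prop)]
    refine setLIntegral_congr_fun measurableSet_Ioi fun t (ht : 0 < t) => ?_
    rw [ker_lint μ _ _ (by fun_prop) (fun x => by positivity),
      ker_lint (gam d) _ _ (by fun_prop) (fun x => by positivity),
      lap μ α s hs ξ hξ hchar t ht]
  have right : ∫⁻ v, (∫⁻ t in Ioi (0:ℝ), ENNReal.ofReal (t ^ (-(l/2) - 1) *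
        ker (l/2) ((2 * s * ‖v‖) ^ α * t ^ (α / 2)))) ∂(gam d) =
      ENNReal.ofReal ((2 * s) ^ l * (Real.Gamma (1 - l / α) / |l / 2|) *
        (Real.Gamma (((d : ℝ) + l) / 2) / Real.Gamma ((d : ℝ) / 2))) := by
    rw [ENNReal.ofReal_mul (by positivity), ← gam_moment d hd l hl1,
      ← lintegral_const_mul _ (by fun_prop)]
    refine lintegral_congr_ae (hne.mono fun v hv => ?_)
    have hv' : 0 < ‖v‖ := norm_pos_iff.mpr hv
    simp only
    rw [J_all (l/2) (α/2) _ ha0 (by positivity) (by linarith) (by positivity),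
      ← ENNReal.ofReal_mul (by positivity), ← rpow_mul (by positivity),
      show l / 2 / (α / 2) = l / α by field_simp, mul_div_cancel₀ _ hα0.ne',
      mul_rpow (by positivity) (by positivity)]
    congr 1; ring
  rw [right] at main
  have hm := (ker_cont (l/2)).measurable
  have hJm : Measurable fun ω => ∫⁻ t in Ioi (0:ℝ), ENNReal.ofReal (t ^ (-(l/2) - 1) *
        ker (l/2) (‖ξ ω‖ ^ 2 * t ^ (1:ℝ))) := by
    apply Measurable.lintegral_prod_right'
      (f := fun q : Ω × ℝ => ENNReal.ofReal (q.2 ^ (-(l/2) - 1) *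
        ker (l/2) (‖ξ q.1‖ ^ 2 * q.2 ^ (1:ℝ))))
    fun_prop
  have hfin := ae_lt_top hJm (by rw [main]; exact ENNReal.ofReal_ne_top)
  have left : ∫⁻ ω, (∫⁻ t in Ioi (0:ℝ), ENNReal.ofReal (t ^ (-(l/2) - 1) *
        ker (l/2) (‖ξ ω‖ ^ 2 * t ^ (1:ℝ)))) ∂μ =
      ENNReal.ofReal (Real.Gamma (1 - l / 2) / |l / 2|) * ∫⁻ ω, ENNReal.ofReal (‖ξ ω‖ ^ l) ∂μ := by
    rw [← lintegral_const_mul _ (by fun_prop)]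
    refine lintegral_congr_ae (hfin.mono fun ω hω => ?_)
    simp only
    rcases eq_or_ne (ξ ω) 0 with h0 | h0
    · rcases hl0.lt_or_gt with hneg | hpos
      · exfalso
        have := J_zero_neg (l/2) (by linarith)
        simp only [h0, norm_zero, rpow_one] at hω
        rw [show (0:ℝ) ^ 2 = 0 by norm_num, this] at hω
        exact lt_irrefl _ hω
      · have : ¬ (l / 2 < 0) := by linarith
        simp [h0, ker, this, zero_rpow hl0]
    · have h0' : 0 < ‖ξ ω‖ := norm_pos_iff.mpr h0
      rw [J_all (l/2) 1 _ ha0 one_pos (by linarith) (by positivity),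
        ← ENNReal.ofReal_mul (by positivity), div_one, ← rpow_natCast, ← rpow_mul h0'.le,
        show ((2:ℕ):ℝ) * (l / 2) = l by push_cast; ring]
      congr 1; ring
  rw [left] at main
  rw [integral_eq_lintegral_of_nonneg_ae (Filter.Eventually.of_forall fun ω => by positivity)
    (Measurable.aestronglyMeasurable (by fun_prop))]
  have := congrArg ENNReal.toReal main
  rw [ENNReal.toReal_mul, ENNReal.toReal_ofReal (by positivity),
    ENNReal.toReal_ofReal (by positivity)] at this
  generalize Real.Gamma (1 - l / α) = g1 at *
  generalize Real.Gamma (1 - l / 2) = g2 at *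
  field_simp at this ⊢
  linarith
end

section
/- Let ξ' and ξ'' be independent random vectors in ℝ^d with characteristic functions exp(-‖u‖_{F₁}^α) and exp(-‖u‖_{F₂}^α) respectively, where α ∈ [1,2] and F₁, F₂ are centred star bodies. Let f_{ξ'}, f_{ξ''}, f_ξ be the densities of ξ', ξ'' and ξ = ξ' + ξ''. Then f_ξ(0)^{-α/d} ≥ f_{ξ'}(0)^{-α/d} + f_{ξ''}(0)^{-α/d}, with equality if F₁ and F₂ are dilates of each other. -/
open MeasureTheory ProbabilityTheory Real Set
open scoped RealInnerProductSpace Pointwise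

/-- Measurable `α`-homogeneous functions bounded below by a multiple of `‖x‖ ^ α`. -/
structure HomFn {d : ℕ} (α : ℝ) (N : EuclideanSpace ℝ (Fin d) → ℝ) : Prop where
  meas : Measurable N
  hom : ∀ t : ℝ, 0 < t → ∀ x, N (t • x) = t ^ α * N x
  low : ∃ c : ℝ, 0 < c ∧ ∀ x, c * ‖x‖ ^ α ≤ N x

theorem HomFn.integrable {d : ℕ} (hd : 1 ≤ d) {α : ℝ} (hα : 1 ≤ α)
    {N : EuclideanSpace ℝ (Fin d) → ℝ} (h : HomFn α N) :
    Integrable (fun x => rexp (-N x)) := by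
  obtain ⟨c, hc, hl⟩ := h.low
  haveI : Nontrivial (EuclideanSpace ℝ (Fin d)) := by
    apply Module.nontrivial_of_finrank_pos (R := ℝ)
    simp; omega
  have h1 : Integrable (fun x : EuclideanSpace ℝ (Fin d) => rexp (-c * ‖x‖ ^ α)) := by
    have := (integrable_fun_norm_addHaar (volume : Measure (EuclideanSpace ℝ (Fin d)))
      (f := fun y : ℝ => rexp (-c * y ^ α))).2 ?_
    · exact this
    · have h2 := integrableOn_rpow_mul_exp_neg_mul_rpow (p := α)
        (s := ((d - 1 : ℕ) : ℝ)) (b := c)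
        (by have : (0:ℝ) ≤ ((d - 1 : ℕ) : ℝ) := Nat.cast_nonneg _
            linarith) (by linarith) hc
      simpa using h2
  refine h1.mono' (h.meas.neg.exp.aestronglyMeasurable) (ae_of_all _ fun x => ?_)
  rw [Real.norm_eq_abs, abs_of_pos (exp_pos _)]
  apply Real.exp_le_exp.2
  have := hl x
  linarith

theorem HomFn.pos {d : ℕ} (hd : 1 ≤ d) {α : ℝ} (hα : 1 ≤ α)
    {N : EuclideanSpace ℝ (Fin d) → ℝ} (h : HomFn α N) :
    0 < ∫ x, rexp (-N x) := by
  exact integral_exp_pos (h.integrable hd hα)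

theorem HomFn.scale {d : ℕ} {α : ℝ} (hα : 1 ≤ α)
    {N : EuclideanSpace ℝ (Fin d) → ℝ} (h : HomFn α N) {t : ℝ} (ht : 0 < t) :
    ∫ x, rexp (-(t * N x)) = t ^ (-(d / α)) * ∫ x, rexp (-N x) := by
  have ha : 0 < α := by linarith
  have hs : 0 < t ^ (1 / α) := rpow_pos_of_pos ht _
  have h1 := Measure.integral_comp_smul (volume : Measure (EuclideanSpace ℝ (Fin d)))
    (fun x => rexp (-N x)) (t ^ (1 / α))
  have h2 : ∀ x, N (t ^ (1 / α) • x) = t * N x := by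
    intro x
    rw [h.hom _ hs, ← rpow_mul ht.le, one_div_mul_cancel ha.ne', rpow_one]
  simp only [h2] at h1
  rw [h1, finrank_euclideanSpace_fin, smul_eq_mul, abs_of_pos (by positivity)]
  congr 1
  rw [← rpow_natCast, ← rpow_mul ht.le, ← rpow_neg ht.le]
  congr 1
  ring

theorem HomFn.const_mul {d : ℕ} {α : ℝ}
    {N : EuclideanSpace ℝ (Fin d) → ℝ} (h : HomFn α N) {t : ℝ} (ht : 0 < t) :
    HomFn α (fun x => t * N x) := by
  obtain ⟨c, hc, hl⟩ := h.low
  refine ⟨h.meas.const_mul t, fun s hs x => ?_, t * c, by positivity, fun x => ?_⟩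
  · simp only [h.hom s hs]; ring
  · rw [mul_assoc]; exact mul_le_mul_of_nonneg_left (hl x) ht.le

theorem HomFn.add {d : ℕ} {α : ℝ}
    {N M : EuclideanSpace ℝ (Fin d) → ℝ} (h : HomFn α N) (h' : HomFn α M) :
    HomFn α (fun x => N x + M x) := by
  obtain ⟨c, hc, hl⟩ := h.low
  obtain ⟨c', hc', hl'⟩ := h'.low
  refine ⟨h.meas.add h'.meas, fun s hs x => ?_, c + c', by positivity, fun x => ?_⟩
  · simp only [h.hom s hs, h'.hom s hs]; ring
  · rw [add_mul]; exact add_le_add (hl x) (hl' x)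

theorem HomFn.holder {d : ℕ} (hd : 1 ≤ d) {α : ℝ} (hα : 1 ≤ α)
    {N M : EuclideanSpace ℝ (Fin d) → ℝ} (h : HomFn α N) (h' : HomFn α M)
    {l m : ℝ} (hl : 0 < l) (hm : 0 < m) (hlm : l + m = 1) :
    ∫ x, rexp (-(N x + M x)) ≤
      (∫ x, rexp (-(l⁻¹ * N x))) ^ l * (∫ x, rexp (-(m⁻¹ * M x))) ^ m := by
  have hpq : (l⁻¹).HolderConjugate m⁻¹ := by
    rw [Real.holderConjugate_iff]
    refine ⟨(one_lt_inv₀ hl).2 (by linarith), by simpa using hlm⟩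
  have key : ∀ (K : EuclideanSpace ℝ (Fin d) → ℝ), HomFn α K → ∀ r : ℝ, 0 < r →
      MemLp (fun x => rexp (-K x)) (ENNReal.ofReal r⁻¹) := by
    intro K hK r hr
    have hr' : 0 < r⁻¹ := inv_pos.2 hr
    have hmK : AEStronglyMeasurable (fun x => rexp (-K x)) volume :=
      hK.meas.neg.exp.aestronglyMeasurable
    rw [← integrable_norm_rpow_iff hmK
      (by simpa using hr) ENNReal.ofReal_ne_top]
    refine ((hK.const_mul hr').integrable hd hα).congr (ae_of_all _ fun x => ?_)
    simp only [Real.norm_eq_abs, abs_of_pos (exp_pos _), ENNReal.toReal_ofReal hr'.le]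
    rw [← Real.exp_mul]
    congr 1; ring
  have := integral_mul_le_Lp_mul_Lq_of_nonneg (μ := volume) hpq
    (f := fun x => rexp (-N x)) (g := fun x => rexp (-M x))
    (ae_of_all _ fun x => (exp_pos _).le) (ae_of_all _ fun x => (exp_pos _).le)
    (key N h l hl) (key M h' m hm)
  simp only [← Real.exp_add, ← Real.exp_mul, one_div, inv_inv] at this
  have t1 : ∀ x, -(N x + M x) = -N x + -M x := fun x => by ring
  have t2 : ∀ x, -(l⁻¹ * N x) = -N x * l⁻¹ := fun x => by ring
  have t3 : ∀ x, -(m⁻¹ * M x) = -M x * m⁻¹ := fun x => by ring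
  simp only [t1, t2, t3]
  exact this

theorem HomFn.main_ineq {d : ℕ} (hd : 1 ≤ d) {α : ℝ} (hα : 1 ≤ α)
    {N M : EuclideanSpace ℝ (Fin d) → ℝ} (h : HomFn α N) (h' : HomFn α M) :
    (∫ x, rexp (-N x)) ^ (-(α / d)) + (∫ x, rexp (-M x)) ^ (-(α / d)) ≤
    (∫ x, rexp (-(N x + M x))) ^ (-(α / d)) := by
  have hI := h.pos hd hα
  have hJ := h'.pos hd hα
  have hK := (h.add h').pos hd hα
  have hd0 : (0:ℝ) < d := by exact_mod_cast hd
  have ha : 0 < α := by linarith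
  set I := ∫ x, rexp (-N x)
  set J := ∫ x, rexp (-M x)
  set K := ∫ x, rexp (-(N x + M x))
  set a := I ^ (-(α / d)) with hadef
  set b := J ^ (-(α / d)) with hbdef
  have ha0 : 0 < a := rpow_pos_of_pos hI _
  have hb0 : 0 < b := rpow_pos_of_pos hJ _
  have hs : 0 < a + b := by positivity
  have hl : 0 < a / (a + b) := by positivity
  have hm : 0 < b / (a + b) := by positivity
  have hlm : a / (a + b) + b / (a + b) = 1 := by field_simp
  have H := h.holder hd hα h' hl hm hlm
  have key : ∀ X : ℝ, 0 < X → ((X ^ (-(α / d)) / (a + b))⁻¹) ^ (-((d:ℝ) / α)) * X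
      = (a + b) ^ (-((d:ℝ) / α)) := by
    intro X hX
    rw [inv_div, Real.div_rpow hs.le (by positivity), ← rpow_mul hX.le]
    have : -(α / d) * -((d:ℝ) / α) = 1 := by field_simp
    rw [this, rpow_one]
    field_simp
  rw [h.scale hα (inv_pos.2 hl), h'.scale hα (inv_pos.2 hm), key I hI, key J hJ,
    ← rpow_add (by positivity), hlm, rpow_one] at H
  have := Real.rpow_le_rpow_of_nonpos hK H (z := -(α / d)) (by
    have : 0 < α / d := by positivity
    linarith)
  rw [← rpow_mul hs.le] at this
  have h1 : -((d:ℝ) / α) * -(α / d) = 1 := by field_simp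
  rwa [h1, rpow_one] at this

theorem HomFn.main_eq {d : ℕ} (hd : 1 ≤ d) {α : ℝ} (hα : 1 ≤ α)
    {N : EuclideanSpace ℝ (Fin d) → ℝ} (h : HomFn α N) {k : ℝ} (hk : 0 < k) :
    (∫ x, rexp (-(N x + k * N x))) ^ (-(α / d)) = 
    (∫ x, rexp (-N x)) ^ (-(α / d)) + (∫ x, rexp (-(k * N x))) ^ (-(α / d)) := by
  have hI := h.pos hd hα
  have hd0 : (0:ℝ) < d := by exact_mod_cast hd
  have ha : 0 < α := by linarith
  have e : ∀ x, N x + k * N x = (1 + k) * N x := fun x => by ring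
  simp only [e]
  have key : ∀ t : ℝ, 0 < t → (∫ x, rexp (-(t * N x))) ^ (-(α / d)) =
      t * (∫ x, rexp (-N x)) ^ (-(α / d)) := by
    intro t ht
    rw [h.scale hα ht, Real.mul_rpow (by positivity) hI.le, ← rpow_mul ht.le]
    have h1 : -((d:ℝ) / α) * -(α / d) = 1 := by field_simp
    rw [h1, rpow_one]
  rw [key _ (by positivity), key _ hk]
  ring

theorem gauge_homFn {d : ℕ} {α : ℝ} (hα : 1 ≤ α)
    {F : Set (EuclideanSpace ℝ (Fin d))} (hF : IsCompact F)
    (h0 : (0 : EuclideanSpace ℝ (Fin d)) ∈ interior F)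
    (hm : Measurable (fun u => gauge F u ^ α)) :
    HomFn α (fun w => gauge F (-(2 * π) • w) ^ α) := by
  have ha : 0 < α := by linarith
  have habs : Absorbent ℝ F := absorbent_nhds_zero (mem_interior_iff_mem_nhds.1 h0)
  obtain ⟨r, hr, hsub⟩ := hF.isBounded.subset_closedBall_lt 0 0
  refine ⟨hm.comp (measurable_const_smul _), fun t ht x => ?_,
    ((2 * π) / r) ^ α, by positivity, fun x => ?_⟩
  · rw [smul_comm, gauge_smul_of_nonneg ht.le, smul_eq_mul,
      Real.mul_rpow ht.le (gauge_nonneg _)]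
  · rw [← Real.mul_rpow (by positivity) (norm_nonneg _)]
    apply Real.rpow_le_rpow (by positivity) _ ha.le
    have := le_gauge_of_subset_closedBall (x := -(2 * π) • x) habs hr.le hsub
    rw [norm_smul, norm_neg, Real.norm_eq_abs, abs_of_pos (by positivity)] at this
    calc _ = 2 * π * ‖x‖ / r := by ring
      _ ≤ _ := this

open FourierTransform in
theorem density_zero {d : ℕ} (P : Measure (EuclideanSpace ℝ (Fin d))) [IsProbabilityMeasure P]
    (f : EuclideanSpace ℝ (Fin d) → ℝ) (hf : Continuous f)
    (hP : P = volume.withDensity (fun x => ENNReal.ofReal (f x)))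
    (M : EuclideanSpace ℝ (Fin d) → ℝ)
    (hM : ∀ u, charFun P u = Complex.exp (Complex.ofReal (-M u)))
    (hint : Integrable (fun w : EuclideanSpace ℝ (Fin d) => rexp (-M (-(2 * π) • w))))
    (hpos : 0 < ∫ w : EuclideanSpace ℝ (Fin d), rexp (-M (-(2 * π) • w))) :
    f 0 = ∫ w : EuclideanSpace ℝ (Fin d), rexp (-M (-(2 * π) • w)) := by
  set g : EuclideanSpace ℝ (Fin d) → ℂ := fun x => ((max (f x) 0 : ℝ) : ℂ) with hg
  have hgc : Continuous g := by fun_prop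
  have hgi0 : Integrable (fun x => max (f x) 0) := by
    refine ⟨(by fun_prop : Continuous fun x => max (f x) 0).aestronglyMeasurable, ?_⟩
    rw [hasFiniteIntegral_iff_ofReal (f := fun x => max (f x) 0) (ae_of_all _ fun x => le_max_right _ _)]
    have h1 : P univ = 1 := measure_univ
    rw [hP, withDensity_apply _ MeasurableSet.univ, Measure.restrict_univ] at h1
    have : ∀ x, ENNReal.ofReal (max (f x) 0) = ENNReal.ofReal (f x) := fun x => by
      simp
    simp only [this, h1]
    exact ENNReal.one_lt_top
  have hgi : Integrable g := hgi0.ofReal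
  have hF : ∀ w, 𝓕 g w = ((rexp (-M (-(2 * π) • w)) : ℝ) : ℂ) := by
    intro w
    have := hM (-(2 * π) • w)
    rw [charFun_apply, hP, integral_withDensity_eq_integral_toReal_smul
      (by fun_prop) (ae_of_all _ fun x => ENNReal.ofReal_lt_top)] at this
    rw [Complex.ofReal_exp, ← this, Real.fourier_eq']
    congr 1
    ext x
    rw [ENNReal.toReal_ofReal', inner_smul_right, hg, smul_eq_mul, Complex.real_smul, mul_comm]
    congr 3
    push_cast
    ring
  have hFi : Integrable (𝓕 g) := by
    rw [show 𝓕 g = _ from funext hF]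
    exact hint.ofReal
  have inv := congrFun (hgc.fourierInv_fourier_eq hgi hFi) 0
  rw [Real.fourierInv_eq'] at inv
  simp only [inner_zero_right, mul_zero, Complex.ofReal_zero, zero_mul, Complex.exp_zero, one_smul,
    hF] at inv
  rw [hg, integral_complex_ofReal] at inv
  have inv' := Complex.ofReal_injective inv
  rw [inv'] at hpos ⊢
  rcases le_total (f 0) 0 with h | h
  · rw [max_eq_right h] at hpos; exact absurd hpos (lt_irrefl _)
  · rw [max_eq_left h]

/-- If `ξ'` and `ξ''` are independent symmetric α-stable random vectors in `ℝ^d`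
(`α ∈ [1,2]`) with associated star bodies `F₁` and `F₂`, and `f₁, f₂, f` are the
densities of `ξ'`, `ξ''` and `ξ = ξ' + ξ''`, then
`f(0)^{-α/d} ≥ f₁(0)^{-α/d} + f₂(0)^{-α/d}`, with equality if `F₁` and `F₂` are
dilates of each other. -/
theorem stable_density_radial_sum_inequality {d : ℕ} (hd : 1 ≤ d) {Ω : Type*}
    [MeasurableSpace Ω] (μ : Measure Ω) [IsProbabilityMeasure μ]
    (α : ℝ) (hα : α ∈ Set.Icc (1 : ℝ) 2)
    (F₁ F₂ : Set (EuclideanSpace ℝ (Fin d)))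
    (hF₁comp : IsCompact F₁) (hF₂comp : IsCompact F₂)
    (hF₁0 : (0 : EuclideanSpace ℝ (Fin d)) ∈ interior F₁)
    (hF₂0 : (0 : EuclideanSpace ℝ (Fin d)) ∈ interior F₂)
    (ξ' ξ'' : Ω → EuclideanSpace ℝ (Fin d)) (hξ' : Measurable ξ') (hξ'' : Measurable ξ'')
    (hindep : IndepFun ξ' ξ'' μ)
    (hchar' : ∀ u : EuclideanSpace ℝ (Fin d),
      ∫ ω, Complex.exp (Complex.ofReal ⟪u, ξ' ω⟫ * Complex.I) ∂μ
        = Complex.exp (Complex.ofReal (-(gauge F₁ u ^ α))))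
    (hchar'' : ∀ u : EuclideanSpace ℝ (Fin d),
      ∫ ω, Complex.exp (Complex.ofReal ⟪u, ξ'' ω⟫ * Complex.I) ∂μ
        = Complex.exp (Complex.ofReal (-(gauge F₂ u ^ α))))
    (f₁ f₂ f : EuclideanSpace ℝ (Fin d) → ℝ)
    (hd₁ : Measure.map ξ' μ = volume.withDensity (fun x => ENNReal.ofReal (f₁ x)))
    (hd₂ : Measure.map ξ'' μ = volume.withDensity (fun x => ENNReal.ofReal (f₂ x)))
    (hdf : Measure.map (fun ω => ξ' ω + ξ'' ω) μ
        = volume.withDensity (fun x => ENNReal.ofReal (f x)))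
    (hf₁ : Continuous f₁) (hf₂ : Continuous f₂) (hf : Continuous f) :
    f 0 ^ (-(α / d)) ≥ f₁ 0 ^ (-(α / d)) + f₂ 0 ^ (-(α / d)) ∧
    ((∃ c : ℝ, 0 < c ∧ F₂ = c • F₁) →
      f 0 ^ (-(α / d)) = f₁ 0 ^ (-(α / d)) + f₂ 0 ^ (-(α / d))) := by
  have hα1 := hα.1
  have cf : ∀ (ζ : Ω → EuclideanSpace ℝ (Fin d)), Measurable ζ → ∀ u,
      charFun (Measure.map ζ μ) u =
        ∫ ω, Complex.exp (Complex.ofReal ⟪u, ζ ω⟫ * Complex.I) ∂μ := by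
    intro ζ hζ u
    rw [charFun_apply, integral_map hζ.aemeasurable (by fun_prop)]
    simp only [real_inner_comm]
  have hms : ∀ (P : Measure (EuclideanSpace ℝ (Fin d))) [IsProbabilityMeasure P]
      (M : EuclideanSpace ℝ (Fin d) → ℝ),
      (∀ u, charFun P u = Complex.exp (Complex.ofReal (-M u))) → Measurable M := by
    intro P _ M hM
    have : M = fun u => -Real.log (charFun P u).re := by
      ext u
      rw [hM u, ← Complex.ofReal_exp, Complex.ofReal_re, Real.log_exp, neg_neg]
    rw [this]
    exact (Complex.measurable_re.comp measurable_charFun).log.neg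
  haveI := Measure.isProbabilityMeasure_map (μ := μ) hξ'.aemeasurable
  haveI := Measure.isProbabilityMeasure_map (μ := μ) hξ''.aemeasurable
  haveI := Measure.isProbabilityMeasure_map (μ := μ) (hξ'.add hξ'').aemeasurable
  have c1 : ∀ u, charFun (Measure.map ξ' μ) u =
      Complex.exp (Complex.ofReal (-(gauge F₁ u ^ α))) := fun u => by rw [cf _ hξ', hchar']
  have c2 : ∀ u, charFun (Measure.map ξ'' μ) u =
      Complex.exp (Complex.ofReal (-(gauge F₂ u ^ α))) := fun u => by rw [cf _ hξ'', hchar'']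
  have c3 : ∀ u, charFun (Measure.map (fun ω => ξ' ω + ξ'' ω) μ) u =
      Complex.exp (Complex.ofReal (-(gauge F₁ u ^ α + gauge F₂ u ^ α))) := fun u => by
    rw [hindep.charFun_map_fun_add_eq_mul hξ'.aemeasurable hξ''.aemeasurable, Pi.mul_apply,
      c1, c2, ← Complex.exp_add]
    congr 1
    push_cast
    ring
  have H1 := gauge_homFn hα1 hF₁comp hF₁0 (hms _ _ c1)
  have H2 := gauge_homFn hα1 hF₂comp hF₂0 (hms _ _ c2)
  have H3 := H1.add H2
  have e1 := density_zero _ f₁ hf₁ hd₁ (fun u => gauge F₁ u ^ α) c1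
    (H1.integrable hd hα1) (H1.pos hd hα1)
  have e2 := density_zero _ f₂ hf₂ hd₂ (fun u => gauge F₂ u ^ α) c2
    (H2.integrable hd hα1) (H2.pos hd hα1)
  have e3 := density_zero _ f hf hdf (fun u => gauge F₁ u ^ α + gauge F₂ u ^ α) c3
    (H3.integrable hd hα1) (H3.pos hd hα1)
  rw [e1, e2, e3]
  refine ⟨H1.main_ineq hd hα1 H2, ?_⟩
  rintro ⟨c, hc, hFc⟩
  have hk : ∀ u, gauge F₂ u ^ α = (c⁻¹) ^ α * gauge F₁ u ^ α := by
    intro u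
    rw [hFc, gauge_smul_left_of_nonneg hc.le, Pi.smul_apply, smul_eq_mul,
      Real.mul_rpow (by positivity) (gauge_nonneg _)]
  simp only [hk]
  exact H1.main_eq hd hα1 (by positivity)
end
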